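/- arXiv:2104.02795 — 7 statements merged into one kernel-verified Lean document; each statement's English description precedes it below -/
import Mathlib

section
/- Let γ > 0 and μ ≥ 0, and define V_γ : ℝⁿ → ℝⁿ by V_γ(ξ) = (μ² + |ξ|²)^{γ/2} ξ. Then there exist positive constants c₁(γ) and c₂(γ) such that c₁(γ)|ξ−η| ≤ |V_γ(ξ) − V_γ(η)| / (μ² + |ξ|² + |η|²)^{γ/2} ≤ c₂(γ)|ξ−η| for all ξ, η ∈ ℝⁿ. -/
theorem aux_bern (s : ℝ) (hs : 0 < s) (a b : ℝ) (hb : 0 ≤ b) (hab : b ≤ a) (ha : 0 < a) :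
    a * (a ^ s - b ^ s) ≤ (1 + s) * a ^ s * (a - b) := by
  obtain ⟨t, ht⟩ : ∃ t, t = b / a := ⟨_, rfl⟩
  have ht0 : 0 ≤ t := by rw [ht]; positivity
  have ht1 : t ≤ 1 := by rw [ht]; exact (div_le_one ha).2 hab
  have hbt : b = t * a := by rw [ht]; field_simp
  have h1 := one_add_mul_self_le_rpow_one_add (s := t - 1) (by linarith) (p := 1 + s) (by linarith)
  have h2 : t ^ (1 + s) ≤ t ^ s := by
    rw [Real.rpow_add_of_nonneg ht0 zero_le_one hs.le, Real.rpow_one]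
    have := Real.rpow_nonneg ht0 s
    nlinarith
  have h3 : 1 - t ^ s ≤ (1 + s) * (1 - t) := by
    rw [show 1 + (t - 1) = t by ring] at h1
    linarith
  rw [hbt, Real.mul_rpow ht0 ha.le]
  have : 0 ≤ a * a ^ s := mul_nonneg ha.le (Real.rpow_nonneg ha.le s)
  nlinarith [mul_le_mul_of_nonneg_left h3 this]

theorem aux_main (s : ℝ) (hs : 0 < s) (n : ℕ) (μ : ℝ) (x y : EuclideanSpace ℝ (Fin n))
    (hxy : ‖y‖ ≤ ‖x‖) :
    (2 * 2 ^ s)⁻¹ * ‖x - y‖ ≤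
      ‖(μ ^ 2 + ‖x‖ ^ 2) ^ s • x - (μ ^ 2 + ‖y‖ ^ 2) ^ s • y‖ /
        (μ ^ 2 + ‖x‖ ^ 2 + ‖y‖ ^ 2) ^ s ∧
    ‖(μ ^ 2 + ‖x‖ ^ 2) ^ s • x - (μ ^ 2 + ‖y‖ ^ 2) ^ s • y‖ /
        (μ ^ 2 + ‖x‖ ^ 2 + ‖y‖ ^ 2) ^ s ≤ (3 + 2 * s) * ‖x - y‖ := by
  have hy0 := norm_nonneg y
  have hx0 := norm_nonneg x
  have hab : μ ^ 2 + ‖y‖ ^ 2 ≤ μ ^ 2 + ‖x‖ ^ 2 := by gcongr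
  have hb : 0 ≤ μ ^ 2 + ‖y‖ ^ 2 := by positivity
  rcases (hb.trans hab).eq_or_lt with h0 | ha
  · have : ‖x‖ = 0 := by nlinarith [sq_nonneg μ]
    have hx : x = 0 := norm_eq_zero.1 this
    have hy : y = 0 := norm_eq_zero.1 (by linarith)
    simp [hx, hy]
  have hAB := Real.rpow_le_rpow hb hab hs.le
  have hB0 := Real.rpow_nonneg hb s
  have hbern := aux_bern s hs _ _ hb hab ha
  have hAD : (μ ^ 2 + ‖x‖ ^ 2) ^ s ≤ (μ ^ 2 + ‖x‖ ^ 2 + ‖y‖ ^ 2) ^ s :=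
    Real.rpow_le_rpow ha.le (by nlinarith) hs.le
  have hDA : (μ ^ 2 + ‖x‖ ^ 2 + ‖y‖ ^ 2) ^ s ≤ 2 ^ s * (μ ^ 2 + ‖x‖ ^ 2) ^ s := by
    rw [← Real.mul_rpow (by norm_num) ha.le]
    exact Real.rpow_le_rpow (by positivity) (by nlinarith [sq_nonneg μ]) hs.le
  have hA0 : 0 < (μ ^ 2 + ‖x‖ ^ 2) ^ s := Real.rpow_pos_of_pos ha s
  have h2 : (0:ℝ) < 2 ^ s := by positivity
  obtain ⟨a, haa⟩ : ∃ a, a = μ ^ 2 + ‖x‖ ^ 2 := ⟨_, rfl⟩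
  have hba : a - (μ ^ 2 + ‖y‖ ^ 2) = (‖x‖ - ‖y‖) * (‖x‖ + ‖y‖) := by rw [haa]; ring
  have hax : ‖x‖ ^ 2 ≤ a := by nlinarith [sq_nonneg μ]
  rw [← haa] at hab ha hAB hbern hAD hDA hA0 ⊢
  generalize (a + ‖y‖ ^ 2) ^ s = D at *
  generalize (μ ^ 2 + ‖y‖ ^ 2) ^ s = B at *
  generalize a ^ s = A at *
  generalize (2:ℝ) ^ s = T at *
  have hD0 : 0 < D := hA0.trans_le hAD
  have hd := norm_sub_norm_le x y
  constructor
  · have key : A / 2 * ‖x - y‖ ^ 2 ≤ ‖A • x - B • y‖ * ‖x - y‖ := by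
      refine le_trans ?_ (real_inner_le_norm _ _)
      have e := norm_sub_sq_real x y
      simp only [inner_sub_left, inner_sub_right, real_inner_smul_left, real_inner_self_eq_norm_sq,
        real_inner_comm x y] at e ⊢
      have h1 : 0 ≤ (A - B) * (‖x‖ ^ 2 - ‖y‖ ^ 2) :=
        mul_nonneg (by linarith) (by nlinarith)
      have h2 : 0 ≤ B * ‖x - y‖ ^ 2 := by positivity
      rw [e] at h2 ⊢
      nlinarith
    have key2 : A / 2 * ‖x - y‖ ≤ ‖A • x - B • y‖ := by
      rcases (norm_nonneg (x - y)).eq_or_lt with h | h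
      · rw [← h]; simp
      · refine le_of_mul_le_mul_right ?_ h
        linarith
    rw [le_div_iff₀ hD0]
    refine le_trans ?_ key2
    have : (2 * T)⁻¹ * D ≤ A / 2 := by
      rw [inv_mul_le_iff₀ (by positivity)]; linarith
    nlinarith [mul_le_mul_of_nonneg_right this (norm_nonneg (x - y))]
  · rw [div_le_iff₀ hD0]
    have e : A • x - B • y = A • (x - y) + (A - B) • y := by
      rw [smul_sub, sub_smul]; abel
    have h1 : ‖A • x - B • y‖ ≤ A * ‖x - y‖ + (A - B) * ‖y‖ := by
      rw [e]
      refine (norm_add_le _ _).trans ?_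
      rw [norm_smul, norm_smul, Real.norm_of_nonneg hA0.le, Real.norm_of_nonneg (sub_nonneg.2 hAB)]
    have h3 : a * ((A - B) * ‖y‖) ≤ a * (2 * (1 + s) * A * ‖x - y‖) := by
      rw [hba] at hbern
      have hq : (‖x‖ + ‖y‖) * ‖y‖ ≤ 2 * a := by nlinarith
      calc a * ((A - B) * ‖y‖) = (a * (A - B)) * ‖y‖ := by ring
        _ ≤ ((1 + s) * A * ((‖x‖ - ‖y‖) * (‖x‖ + ‖y‖))) * ‖y‖ := by gcongr
        _ = (1 + s) * A * (‖x‖ - ‖y‖) * ((‖x‖ + ‖y‖) * ‖y‖) := by ring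
        _ ≤ (1 + s) * A * (‖x‖ - ‖y‖) * (2 * a) := by
            have : 0 ≤ ‖x‖ - ‖y‖ := by linarith
            gcongr
        _ ≤ (1 + s) * A * ‖x - y‖ * (2 * a) := by gcongr
        _ = _ := by ring
    have h4 := le_of_mul_le_mul_left h3 ha
    calc _ ≤ (3 + 2 * s) * ‖x - y‖ * A := by linarith
      _ ≤ _ := by gcongr

/-- **Lemma (Giaquinta-type estimates for `V_γ`).**
Let `γ > 0` and `μ ≥ 0`, and define `V_γ(ξ) = (μ² + |ξ|²)^{γ/2} ξ`.  Then there exist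
positive constants `c₁(γ)` and `c₂(γ)` (depending only on `γ`) such that
`c₁(γ)|ξ−η| ≤ |V_γ(ξ) − V_γ(η)| / (μ² + |ξ|² + |η|²)^{γ/2} ≤ c₂(γ)|ξ−η|`
for all `ξ, η ∈ ℝⁿ`. -/
theorem stmt6 (γ : ℝ) (hγ : 0 < γ) :
    ∃ c₁ c₂ : ℝ, 0 < c₁ ∧ 0 < c₂ ∧
      ∀ (n : ℕ) (μ : ℝ), 0 ≤ μ →
        ∀ ξ η : EuclideanSpace ℝ (Fin n),
          c₁ * ‖ξ - η‖ ≤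
              ‖(μ ^ 2 + ‖ξ‖ ^ 2) ^ (γ / 2) • ξ - (μ ^ 2 + ‖η‖ ^ 2) ^ (γ / 2) • η‖ /
                (μ ^ 2 + ‖ξ‖ ^ 2 + ‖η‖ ^ 2) ^ (γ / 2) ∧
            ‖(μ ^ 2 + ‖ξ‖ ^ 2) ^ (γ / 2) • ξ - (μ ^ 2 + ‖η‖ ^ 2) ^ (γ / 2) • η‖ /
                (μ ^ 2 + ‖ξ‖ ^ 2 + ‖η‖ ^ 2) ^ (γ / 2) ≤ c₂ * ‖ξ - η‖ := by
  refine ⟨(2 * 2 ^ (γ / 2))⁻¹, 3 + 2 * (γ / 2), by positivity, by positivity, ?_⟩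
  intro n μ _ ξ η
  rcases le_total ‖η‖ ‖ξ‖ with h | h
  · exact aux_main (γ / 2) (by positivity) n μ ξ η h
  · have := aux_main (γ / 2) (by positivity) n μ η ξ h
    rw [norm_sub_rev ξ η, norm_sub_rev ((μ ^ 2 + ‖ξ‖ ^ 2) ^ (γ / 2) • ξ),
      add_right_comm (μ ^ 2) (‖ξ‖ ^ 2)]
    exact this
end

section
/- Let γ ∈ (−1/2, 0) and μ ≥ 0. Then for all ξ, η ∈ ℝⁿ: (i) (2γ+1)|ξ−η| ≤ |(μ²+|ξ|²)^γ ξ − (μ²+|η|²)^γ η| / (μ²+|ξ|²+|η|²)^γ ≤ (c(n)/(2γ+1))|ξ−η| for a constant c(n) depending only on n; (ii) defining F(ζ) = (1/(2(γ+1)))(μ²+|ζ|²)^{γ+1}, one has ∇F(ζ) = (μ²+|ζ|²)^γ ζ and ⟨∇F(ξ) − ∇F(η), ξ−η⟩ ≥ (2γ+1)(μ²+|ξ|²+|η|²)^γ |ξ−η|². -/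
open scoped RealInnerProductSpace

lemma aux_scalar {γ μ a b : ℝ} (h1 : -(1 / 2) < γ) (h2 : γ < 0) (hb : 0 ≤ b) (hab : b ≤ a) :
    (μ ^ 2 + b ^ 2) ^ γ * b ≤ (μ ^ 2 + a ^ 2) ^ γ * (-2 * γ * a + (1 + 2 * γ) * b) := by
  rcases hb.eq_or_lt with rfl | hb
  · have : 0 ≤ (μ ^ 2 + a ^ 2) ^ γ := by positivity
    have h3 : 0 ≤ -2 * γ * a := by nlinarith
    simp only [mul_zero, add_zero]
    positivity
  have ha : 0 < a := hb.trans_le hab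
  have hA : 0 < μ ^ 2 + a ^ 2 := by positivity
  have hB : 0 < μ ^ 2 + b ^ 2 := by positivity
  have amgm := Real.geom_mean_le_arith_mean2_weighted (w₁ := -2 * γ) (w₂ := 1 + 2 * γ)
    (by linarith) (by linarith) ha.le hb.le (by ring)
  -- (a/b)^(-2γ) b
  have hr : (μ ^ 2 + a ^ 2) / (μ ^ 2 + b ^ 2) ≤ (a / b) ^ 2 := by
    rw [div_pow, div_le_div_iff₀ hB (by positivity)]
    nlinarith [mul_le_mul_of_nonneg_left (pow_le_pow_left₀ hb.le hab 2) (sq_nonneg μ)]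
  have e1 : ((μ ^ 2 + a ^ 2) / (μ ^ 2 + b ^ 2)) ^ (-γ) ≤ ((a / b) ^ 2) ^ (-γ) :=
    Real.rpow_le_rpow (by positivity) hr (by linarith)
  have e2 : ((a / b) ^ 2) ^ (-γ) * b = a ^ (-2 * γ) * b ^ (1 + 2 * γ) := by
    rw [← Real.rpow_natCast, ← Real.rpow_mul (by positivity), Real.div_rpow ha.le hb.le,
      Real.rpow_add hb, Real.rpow_one]
    have : ((2 : ℕ) : ℝ) * -γ = -2 * γ := by push_cast; ring
    rw [this, show (2 * γ) = -(-2 * γ) by ring, Real.rpow_neg hb.le]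
    field_simp
  have e3 : ((μ ^ 2 + a ^ 2) / (μ ^ 2 + b ^ 2)) ^ (-γ)
      = (μ ^ 2 + b ^ 2) ^ γ / (μ ^ 2 + a ^ 2) ^ γ := by
    rw [Real.div_rpow hA.le hB.le, Real.rpow_neg hA.le, Real.rpow_neg hB.le]
    field_simp
  have hAp : 0 < (μ ^ 2 + a ^ 2) ^ γ := Real.rpow_pos_of_pos hA _
  have e4 : (μ ^ 2 + b ^ 2) ^ γ / (μ ^ 2 + a ^ 2) ^ γ * b ≤ -2 * γ * a + (1 + 2 * γ) * b := by
    rw [← e3]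
    exact (mul_le_mul_of_nonneg_right e1 hb.le).trans (e2.le.trans amgm)
  have := mul_le_mul_of_nonneg_left e4 hAp.le
  calc _ = (μ ^ 2 + a ^ 2) ^ γ * ((μ ^ 2 + b ^ 2) ^ γ / (μ ^ 2 + a ^ 2) ^ γ * b) := by
        field_simp
    _ ≤ _ := this

lemma aux_main_s7 {n : ℕ} {γ μ : ℝ} (h1 : -(1 / 2) < γ) (h2 : γ < 0)
    (ξ η : EuclideanSpace ℝ (Fin n)) (hab : ‖η‖ ≤ ‖ξ‖) :
    ‖(μ ^ 2 + ‖ξ‖ ^ 2) ^ γ • ξ - (μ ^ 2 + ‖η‖ ^ 2) ^ γ • η‖ ≤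
      4 * (μ ^ 2 + ‖ξ‖ ^ 2 + ‖η‖ ^ 2) ^ γ * ‖ξ - η‖ ∧
    (2 * γ + 1) * (μ ^ 2 + ‖ξ‖ ^ 2 + ‖η‖ ^ 2) ^ γ * ‖ξ - η‖ ^ 2 ≤
     ⟪(μ ^ 2 + ‖ξ‖ ^ 2) ^ γ • ξ - (μ ^ 2 + ‖η‖ ^ 2) ^ γ • η, ξ - η⟫ := by
  rcases (norm_nonneg ξ).eq_or_lt with h0 | ha
  · have hx : ξ = 0 := norm_eq_zero.1 h0.symm
    have hy : η = 0 := norm_eq_zero.1 (le_antisymm (hab.trans h0.symm.le) (norm_nonneg _))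
    subst hx hy
    simp
  have hb := norm_nonneg η
  have key := aux_scalar (μ := μ) h1 h2 hb hab
  have hcs : ⟪ξ, η⟫ ≤ ‖ξ‖ * ‖η‖ := real_inner_le_norm ξ η
  have hns : ‖ξ - η‖ ^ 2 = ‖ξ‖ ^ 2 - 2 * ⟪ξ, η⟫ + ‖η‖ ^ 2 := norm_sub_sq_real ξ η
  have htri : ‖ξ‖ - ‖η‖ ≤ ‖ξ - η‖ := norm_sub_norm_le ξ η
  have hin : ⟪(μ ^ 2 + ‖ξ‖ ^ 2) ^ γ • ξ - (μ ^ 2 + ‖η‖ ^ 2) ^ γ • η, ξ - η⟫ =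
      (μ ^ 2 + ‖ξ‖ ^ 2) ^ γ * (‖ξ‖ ^ 2 - ⟪ξ, η⟫) +
      (μ ^ 2 + ‖η‖ ^ 2) ^ γ * (‖η‖ ^ 2 - ⟪ξ, η⟫) := by
    simp only [inner_sub_left, inner_sub_right, real_inner_smul_left,
      real_inner_self_eq_norm_sq, real_inner_comm η ξ]
    rw [real_inner_comm ξ η]
    ring
  have hdec : (μ ^ 2 + ‖ξ‖ ^ 2) ^ γ • ξ - (μ ^ 2 + ‖η‖ ^ 2) ^ γ • η =
      (μ ^ 2 + ‖ξ‖ ^ 2) ^ γ • (ξ - η) +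
      ((μ ^ 2 + ‖ξ‖ ^ 2) ^ γ - (μ ^ 2 + ‖η‖ ^ 2) ^ γ) • η := by
    rw [smul_sub, sub_smul]; abel
  have hDA : (μ ^ 2 + ‖ξ‖ ^ 2 + ‖η‖ ^ 2) ^ γ ≤ (μ ^ 2 + ‖ξ‖ ^ 2) ^ γ :=
    Real.rpow_le_rpow_of_nonpos (by positivity) (by nlinarith) h2.le
  have hA0 : 0 < (μ ^ 2 + ‖ξ‖ ^ 2) ^ γ := by positivity
  have hB0 : 0 ≤ (μ ^ 2 + ‖η‖ ^ 2) ^ γ := by positivity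
  have hD0 : 0 < (μ ^ 2 + ‖ξ‖ ^ 2 + ‖η‖ ^ 2) ^ γ := by positivity
  have hAD : (μ ^ 2 + ‖ξ‖ ^ 2) ^ γ ≤ 2 * (μ ^ 2 + ‖ξ‖ ^ 2 + ‖η‖ ^ 2) ^ γ := by
    have s1 : (2 * (μ ^ 2 + ‖ξ‖ ^ 2)) ^ γ ≤ (μ ^ 2 + ‖ξ‖ ^ 2 + ‖η‖ ^ 2) ^ γ :=
      Real.rpow_le_rpow_of_nonpos (by positivity) (by nlinarith) h2.le
    rw [Real.mul_rpow (by norm_num) (by positivity)] at s1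
    have s2 : (2 : ℝ) ^ (-1 : ℝ) ≤ 2 ^ γ :=
      Real.rpow_le_rpow_of_exponent_le (by norm_num) (by linarith)
    rw [Real.rpow_neg_one] at s2
    nlinarith
  have hBcase : (‖η‖ = 0 ∧ ⟪ξ, η⟫ = 0) ∨
      (μ ^ 2 + ‖ξ‖ ^ 2) ^ γ ≤ (μ ^ 2 + ‖η‖ ^ 2) ^ γ := by
    rcases hb.eq_or_lt with h | h
    · left
      have hy : η = 0 := norm_eq_zero.1 h.symm
      subst hy
      simp
    · right
      exact Real.rpow_le_rpow_of_nonpos (by positivity) (by nlinarith) h2.le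
  rw [hin, hdec, hns]
  have hn1 : ‖(μ ^ 2 + ‖ξ‖ ^ 2) ^ γ • (ξ - η)‖ = (μ ^ 2 + ‖ξ‖ ^ 2) ^ γ * ‖ξ - η‖ := by
    rw [norm_smul, Real.norm_of_nonneg hA0.le]
  have hn2 : ‖((μ ^ 2 + ‖ξ‖ ^ 2) ^ γ - (μ ^ 2 + ‖η‖ ^ 2) ^ γ) • η‖ =
      |(μ ^ 2 + ‖ξ‖ ^ 2) ^ γ - (μ ^ 2 + ‖η‖ ^ 2) ^ γ| * ‖η‖ := by
    rw [norm_smul, Real.norm_eq_abs]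
  have hnn := norm_nonneg (ξ - η)
  have hn3 := norm_add_le ((μ ^ 2 + ‖ξ‖ ^ 2) ^ γ • (ξ - η))
      (((μ ^ 2 + ‖ξ‖ ^ 2) ^ γ - (μ ^ 2 + ‖η‖ ^ 2) ^ γ) • η)
  rw [hn1, hn2] at hn3
  clear hin hdec hn1 hn2
  generalize (μ ^ 2 + ‖ξ‖ ^ 2) ^ γ = A at *
  generalize (μ ^ 2 + ‖η‖ ^ 2) ^ γ = B at *
  generalize (μ ^ 2 + ‖ξ‖ ^ 2 + ‖η‖ ^ 2) ^ γ = D at *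
  generalize ⟪ξ, η⟫ = t at *
  generalize ‖ξ - η‖ = d at *
  generalize ‖ξ‖ = a at *
  generalize ‖η‖ = b at *
  constructor
  · refine hn3.trans ?_
    have h3 : |A - B| * b ≤ A * d := by
      rcases hBcase with ⟨h, _⟩ | h
      · rw [h, mul_zero]; positivity
      · rw [abs_of_nonpos (by linarith)]
        have : -(A - B) * b ≤ A * (-2 * γ * (a - b)) := by nlinarith
        refine this.trans (mul_le_mul_of_nonneg_left ?_ hA0.le)
        nlinarith
    nlinarith
  · have h3 : (2 * γ + 1) * D * (a - b) ^ 2 ≤ (A * a - B * b) * (a - b) := by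
      have : (2 * γ + 1) * A * (a - b) ≤ A * a - B * b := by nlinarith
      have h4 := mul_le_mul_of_nonneg_right this (sub_nonneg.2 hab)
      have h5 : (2 * γ + 1) * D * (a - b) ^ 2 ≤ (2 * γ + 1) * A * (a - b) ^ 2 :=
        mul_le_mul_of_nonneg_right (mul_le_mul_of_nonneg_left hDA (by linarith)) (sq_nonneg _)
      nlinarith
    have h6 : 2 * (2 * γ + 1) * D * (a * b - t) ≤ (A + B) * (a * b - t) := by
      rcases hBcase with ⟨h, h'⟩ | h
      · simp [h, h']
      · refine mul_le_mul_of_nonneg_right ?_ (by linarith)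
        nlinarith
    nlinarith

lemma aux_grad {n : ℕ} {γ μ : ℝ} (h1 : -(1 / 2) < γ)
    (ξ : EuclideanSpace ℝ (Fin n)) :
    gradient (fun ζ : EuclideanSpace ℝ (Fin n) =>
      (1 / (2 * (γ + 1))) * (μ ^ 2 + ‖ζ‖ ^ 2) ^ (γ + 1)) ξ = (μ ^ 2 + ‖ξ‖ ^ 2) ^ γ • ξ := by
  apply HasGradientAt.gradient
  rw [hasGradientAt_iff_hasFDerivAt]
  have hg : γ + 1 ≠ 0 := by linarith
  by_cases h0 : μ ^ 2 + ‖ξ‖ ^ 2 = 0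
  · have hm : μ = 0 := by
      have : μ ^ 2 = 0 := by nlinarith [sq_nonneg μ, sq_nonneg ‖ξ‖]
      simpa using this
    have hx : ξ = 0 := by
      have : ‖ξ‖ ^ 2 = 0 := by nlinarith [sq_nonneg μ, sq_nonneg ‖ξ‖]
      simpa using this
    subst hm hx
    have h := (hasFDerivAt_norm_rpow (0 : EuclideanSpace ℝ (Fin n))
      (p := 2 * (γ + 1)) (by linarith)).const_mul (1 / (2 * (γ + 1)))
    have e : (fun ζ : EuclideanSpace ℝ (Fin n) =>
        (1 / (2 * (γ + 1))) * ((0 : ℝ) ^ 2 + ‖ζ‖ ^ 2) ^ (γ + 1)) =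
        fun ζ => (1 / (2 * (γ + 1))) * ‖ζ‖ ^ (2 * (γ + 1)) := by
      funext ζ
      rw [Real.rpow_mul (norm_nonneg _)]
      simp
    rw [e]
    refine h.congr_fderiv ?_
    simp
  · have h := (((hasStrictFDerivAt_norm_sq ξ).hasFDerivAt.const_add (μ ^ 2)).rpow_const
      (p := γ + 1) (Or.inl h0)).const_mul (1 / (2 * (γ + 1)))
    refine h.congr_fderiv ?_
    ext v
    simp [real_inner_smul_left]
    field_simp

/-- **Lemma (subquadratic analogue, Acerbi–Fusco type).**
For every `γ ∈ (−1/2, 0)` and `μ ≥ 0`: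
(i) `(2γ+1)|ξ−η| ≤ |(μ²+|ξ|²)^γ ξ − (μ²+|η|²)^γ η| / (μ²+|ξ|²+|η|²)^γ ≤ (c(n)/(2γ+1))|ξ−η|`
for a constant `c(n)` depending only on `n`;
(ii) for `F(ζ) = (1/(2(γ+1)))(μ²+|ζ|²)^{γ+1}` one has `∇F(ζ) = (μ²+|ζ|²)^γ ζ` and
`⟨∇F(ξ) − ∇F(η), ξ−η⟩ ≥ (2γ+1)(μ²+|ξ|²+|η|²)^γ |ξ−η|²`. -/
theorem stmt7 (n : ℕ) :
    ∃ c : ℝ, 0 < c ∧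
      ∀ (γ μ : ℝ), -(1 / 2) < γ → γ < 0 → 0 ≤ μ →
        ∀ ξ η : EuclideanSpace ℝ (Fin n),
          ((2 * γ + 1) * ‖ξ - η‖ ≤
              ‖(μ ^ 2 + ‖ξ‖ ^ 2) ^ γ • ξ - (μ ^ 2 + ‖η‖ ^ 2) ^ γ • η‖ /
                (μ ^ 2 + ‖ξ‖ ^ 2 + ‖η‖ ^ 2) ^ γ) ∧
          (‖(μ ^ 2 + ‖ξ‖ ^ 2) ^ γ • ξ - (μ ^ 2 + ‖η‖ ^ 2) ^ γ • η‖ /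
                (μ ^ 2 + ‖ξ‖ ^ 2 + ‖η‖ ^ 2) ^ γ ≤ (c / (2 * γ + 1)) * ‖ξ - η‖) ∧
          (gradient
              (fun ζ : EuclideanSpace ℝ (Fin n) =>
                (1 / (2 * (γ + 1))) * (μ ^ 2 + ‖ζ‖ ^ 2) ^ (γ + 1)) ξ =
            (μ ^ 2 + ‖ξ‖ ^ 2) ^ γ • ξ) ∧
          (⟪(μ ^ 2 + ‖ξ‖ ^ 2) ^ γ • ξ - (μ ^ 2 + ‖η‖ ^ 2) ^ γ • η, ξ - η⟫ ≥
            (2 * γ + 1) * (μ ^ 2 + ‖ξ‖ ^ 2 + ‖η‖ ^ 2) ^ γ * ‖ξ - η‖ ^ 2) := by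
  refine ⟨4, by norm_num, ?_⟩
  intro γ μ h1 h2 _ ξ η
  have hm : ‖(μ ^ 2 + ‖ξ‖ ^ 2) ^ γ • ξ - (μ ^ 2 + ‖η‖ ^ 2) ^ γ • η‖ ≤
      4 * (μ ^ 2 + ‖ξ‖ ^ 2 + ‖η‖ ^ 2) ^ γ * ‖ξ - η‖ ∧
    (2 * γ + 1) * (μ ^ 2 + ‖ξ‖ ^ 2 + ‖η‖ ^ 2) ^ γ * ‖ξ - η‖ ^ 2 ≤
     ⟪(μ ^ 2 + ‖ξ‖ ^ 2) ^ γ • ξ - (μ ^ 2 + ‖η‖ ^ 2) ^ γ • η, ξ - η⟫ := by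
    rcases le_total ‖η‖ ‖ξ‖ with h | h
    · exact aux_main_s7 h1 h2 ξ η h
    · have := aux_main_s7 (μ := μ) h1 h2 η ξ h
      rw [norm_sub_rev ((μ ^ 2 + ‖ξ‖ ^ 2) ^ γ • ξ), norm_sub_rev ξ η, add_right_comm,
        ← inner_neg_neg, neg_sub, neg_sub]
      exact this
  obtain ⟨hU, hI⟩ := hm
  refine ⟨?_, ?_, aux_grad h1 ξ, hI⟩
  · rcases eq_or_ne ξ η with rfl | hne
    · simp
    have hd : 0 < ‖ξ - η‖ := norm_pos_iff.2 (sub_ne_zero.2 hne)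
    have hpos : 0 < μ ^ 2 + ‖ξ‖ ^ 2 + ‖η‖ ^ 2 := by
      by_contra hc
      have hx : ξ = 0 := by
        have : ‖ξ‖ ^ 2 = 0 := by nlinarith [sq_nonneg μ, sq_nonneg ‖ξ‖, sq_nonneg ‖η‖]
        simpa using this
      have hy : η = 0 := by
        have : ‖η‖ ^ 2 = 0 := by nlinarith [sq_nonneg μ, sq_nonneg ‖ξ‖, sq_nonneg ‖η‖]
        simpa using this
      exact hne (hx.trans hy.symm)
    rw [le_div_iff₀ (Real.rpow_pos_of_pos hpos _)]
    have hc := hI.trans (real_inner_le_norm _ _)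
    refine le_of_mul_le_mul_right ?_ hd
    refine le_trans (le_of_eq ?_) hc
    ring
  · have hD : 0 ≤ (μ ^ 2 + ‖ξ‖ ^ 2 + ‖η‖ ^ 2) ^ γ := by positivity
    have hk : 0 < 2 * γ + 1 := by linarith
    have h4 : (4 : ℝ) ≤ 4 / (2 * γ + 1) := by
      rw [le_div_iff₀ hk]; linarith
    refine (div_le_of_le_mul₀ hD (by positivity) (hU.trans (le_of_eq ?_))).trans
      (mul_le_mul_of_nonneg_right h4 (norm_nonneg _))
    ring
end

section
/- For every pair (α, ε) of positive real numbers with α < ε, there exist positive constants β₁(α,ε) and β₂(α,ε,n) such that β₁ |H_ε(ξ) − H_ε(η)| ≤ |H_α(ξ) − H_α(η)| / ((|ξ|−1)_+^ε + (|η|−1)_+^ε)^{(α−ε)/ε} ≤ β₂ |H_ε(ξ) − H_ε(η)| for all ξ, η ∈ ℝⁿ. -/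
/-- `H_α(ξ) = (|ξ|−1)_+^α ξ/|ξ|` (with value `0` at `ξ = 0`). -/
noncomputable def Hmap (n : ℕ) (a : ℝ) (ξ : EuclideanSpace ℝ (Fin n)) :
    EuclideanSpace ℝ (Fin n) :=
  ((max (‖ξ‖ - 1) 0) ^ a / ‖ξ‖) • ξ


theorem core_aux {E : Type*} [NormedAddCommGroup E] [NormedSpace ℝ E] (p s t : ℝ) (u v : E)
    (hp : 0 < p) (hp1 : p < 1) (ht : 0 ≤ t) (hts : t ≤ s) (hs : 0 < s)
    (hu : ‖u‖ = 1) (hv : ‖v‖ ≤ 1) :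
    (1 / p + 2)⁻¹ * ‖s • u - t • v‖ ≤ ‖s ^ p • u - t ^ p • v‖ * (s + t) ^ (1 - p) ∧
    ‖s ^ p • u - t ^ p • v‖ * (s + t) ^ (1 - p) ≤ 6 * ‖s • u - t • v‖ := by
  have hAW : s ^ p * s ^ (1 - p) = s := by
    rw [← Real.rpow_add hs]; simp
  have htt : t ^ p * t ^ (1 - p) = t := by
    rw [← Real.rpow_add_of_nonneg ht hp.le (by linarith)]; simp
  have hB0 : 0 ≤ t ^ p := Real.rpow_nonneg ht p
  have hBA : t ^ p ≤ s ^ p := Real.rpow_le_rpow ht hts hp.le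
  have hWW : t ^ (1 - p) ≤ s ^ (1 - p) := Real.rpow_le_rpow ht hts (by linarith)
  have hY : t ^ p * s ^ (1 - p) ≤ p * t + (1 - p) * s :=
    Real.geom_mean_le_arith_mean2_weighted hp.le (by linarith) ht hs.le (by ring)
  have hW0 : 0 < s ^ (1 - p) := Real.rpow_pos_of_pos hs _
  have hS1 : s ^ (1 - p) ≤ (s + t) ^ (1 - p) :=
    Real.rpow_le_rpow hs.le (by linarith) (by linarith)
  have hS2 : (s + t) ^ (1 - p) ≤ 2 * s ^ (1 - p) := by
    calc (s + t) ^ (1 - p) ≤ (2 * s) ^ (1 - p) :=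
          Real.rpow_le_rpow (by linarith) (by linarith) (by linarith)
      _ = 2 ^ (1 - p) * s ^ (1 - p) := Real.mul_rpow (by norm_num) hs.le
      _ ≤ 2 ^ (1 : ℝ) * s ^ (1 - p) := by
          gcongr
          · norm_num
          · linarith
      _ = _ := by simp
  generalize s ^ p = A at *
  generalize t ^ p = B at *
  generalize s ^ (1 - p) = W at *
  generalize (s + t) ^ (1 - p) = S at *
  have key : ∀ a b : ℝ, 0 ≤ b → b ≤ a → a - b ≤ ‖a • u - b • v‖ := by
    intro a b hb hab
    have h := norm_sub_norm_le (a • u) (b • v)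
    rw [norm_smul, norm_smul, hu, Real.norm_of_nonneg hb, Real.norm_of_nonneg (hb.trans hab)] at h
    nlinarith
  have k1 := key s t ht hts
  have k2 := key A B hB0 hBA
  have tri : ∀ a b : ℝ, 0 ≤ b → b ≤ a → ‖a • u - b • v‖ ≤ (a - b) + b * ‖u - v‖ := by
    intro a b hb hab
    have e : a • u - b • v = (a - b) • u + b • (u - v) := by module
    rw [e]
    refine (norm_add_le _ _).trans ?_
    rw [norm_smul, norm_smul, hu, Real.norm_of_nonneg hb, Real.norm_of_nonneg (sub_nonneg.2 hab),
      mul_one]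
  have t1 := tri s t ht hts
  have t2 := tri A B hB0 hBA
  have m1 : s * ‖u - v‖ ≤ 2 * ‖s • u - t • v‖ := by
    have e : s • (u - v) = (s • u - t • v) - (s - t) • v := by module
    have h : ‖s • (u - v)‖ ≤ ‖s • u - t • v‖ + ‖(s - t) • v‖ := by
      rw [e]; exact norm_sub_le _ _
    rw [norm_smul, norm_smul, Real.norm_of_nonneg hs.le,
      Real.norm_of_nonneg (sub_nonneg.2 hts)] at h
    nlinarith
  have m2 : B * ‖u - v‖ ≤ 2 * ‖A • u - B • v‖ := by
    have e : B • (u - v) = (A • u - B • v) - (A - B) • u := by module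
    have h : ‖B • (u - v)‖ ≤ ‖A • u - B • v‖ + ‖(A - B) • u‖ := by
      rw [e]; exact norm_sub_le _ _
    rw [norm_smul, norm_smul, Real.norm_of_nonneg hB0,
      Real.norm_of_nonneg (sub_nonneg.2 hBA), hu] at h
    linarith
  have hD : 0 ≤ ‖u - v‖ := norm_nonneg _
  have hX : 0 ≤ ‖s • u - t • v‖ := norm_nonneg _
  have hZ : 0 ≤ ‖A • u - B • v‖ := norm_nonneg _
  generalize ‖s • u - t • v‖ = X at *
  generalize ‖A • u - B • v‖ = Z at *
  generalize ‖u - v‖ = D at *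
  have htBW : t ≤ B * W := by rw [← htt]; gcongr
  have hBWs : B * W ≤ s := by rw [← hAW]; gcongr
  constructor
  · have h1 : s - t ≤ 1 / p * (Z * W) := by
      rw [div_mul_eq_mul_div, le_div_iff₀ hp]
      have := mul_le_mul_of_nonneg_right k2 hW0.le
      nlinarith
    have h2 : t * D ≤ 2 * (Z * W) := by
      have := mul_le_mul_of_nonneg_right m2 hW0.le
      have := mul_le_mul_of_nonneg_right htBW hD
      nlinarith
    have h3 : X ≤ (1 / p + 2) * (Z * S) := by
      have : Z * W ≤ Z * S := by gcongr
      have h4 : X ≤ (1 / p + 2) * (Z * W) := by linarith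
      exact h4.trans (by gcongr)
    rw [inv_mul_le_iff₀ (by positivity)]
    exact h3
  · have h1 : Z * W ≤ 3 * X := by
      have a1 := mul_le_mul_of_nonneg_right t2 hW0.le
      have a2 := mul_le_mul_of_nonneg_right hBWs hD
      nlinarith
    have : Z * S ≤ Z * (2 * W) := by gcongr
    linarith

theorem Hmap_aux (n : ℕ) (α ε : ℝ) (hα : 0 < α) (hαε : α < ε)
    (ξ η : EuclideanSpace ℝ (Fin n)) (h1 : 1 < ‖ξ‖) (h2 : ‖η‖ ≤ ‖ξ‖) :
    (1 / (α / ε) + 2)⁻¹ * ‖Hmap n ε ξ - Hmap n ε η‖ ≤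
            ‖Hmap n α ξ - Hmap n α η‖ /
              ((max (‖ξ‖ - 1) 0) ^ ε + (max (‖η‖ - 1) 0) ^ ε) ^ ((α - ε) / ε) ∧
          ‖Hmap n α ξ - Hmap n α η‖ /
              ((max (‖ξ‖ - 1) 0) ^ ε + (max (‖η‖ - 1) 0) ^ ε) ^ ((α - ε) / ε) ≤
            6 * ‖Hmap n ε ξ - Hmap n ε η‖ := by
  have hε : 0 < ε := hα.trans hαε
  have hx : 0 < max (‖ξ‖ - 1) 0 := lt_max_of_lt_left (by linarith)
  have hy : 0 ≤ max (‖η‖ - 1) 0 := le_max_right _ _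
  have hyx : max (‖η‖ - 1) 0 ≤ max (‖ξ‖ - 1) 0 := max_le_max (by linarith) le_rfl
  have hs := Real.rpow_pos_of_pos hx ε
  have ht := Real.rpow_nonneg hy ε
  have hH : ∀ (a : ℝ) (ζ : EuclideanSpace ℝ (Fin n)),
      Hmap n a ζ = (max (‖ζ‖ - 1) 0) ^ a • (‖ζ‖⁻¹ • ζ) := by
    intro a ζ; rw [Hmap, smul_smul, div_eq_mul_inv]
  have hpow : ∀ z : ℝ, 0 ≤ z → z ^ α = (z ^ ε) ^ (α / ε) := by
    intro z hz; rw [← Real.rpow_mul hz, mul_div_cancel₀ _ hε.ne']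
  have hc := core_aux (α / ε) _ _ (‖ξ‖⁻¹ • ξ) (‖η‖⁻¹ • η) (by positivity)
    ((div_lt_one hε).2 hαε) ht (Real.rpow_le_rpow hy hyx hε.le) hs
    (by rw [norm_smul, norm_inv, norm_norm]; exact inv_mul_cancel₀ (by linarith))
    (by rw [norm_smul, norm_inv, norm_norm]; exact inv_mul_le_one)
  rw [hH, hH, hH, hH, hpow _ hx.le, hpow _ hy, div_eq_mul_inv (‖_‖),
    ← Real.rpow_neg (by linarith)]
  have e : -((α - ε) / ε) = 1 - α / ε := by field_simp; ring
  rw [e]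
  exact hc

/-- **Lemma.** For every pair `(α, ε)` of positive reals with `α < ε`, there exist positive
constants `β₁(α,ε)` and `β₂(α,ε,n)` such that
`β₁ |H_ε(ξ) − H_ε(η)| ≤ |H_α(ξ) − H_α(η)| / ((|ξ|−1)_+^ε + (|η|−1)_+^ε)^{(α−ε)/ε}
  ≤ β₂ |H_ε(ξ) − H_ε(η)|` for all `ξ, η ∈ ℝⁿ`. -/
theorem stmt8 (n : ℕ) (α ε : ℝ) (hα : 0 < α) (hαε : α < ε) :
    ∃ β₁ β₂ : ℝ, 0 < β₁ ∧ 0 < β₂ ∧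
      ∀ ξ η : EuclideanSpace ℝ (Fin n),
        β₁ * ‖Hmap n ε ξ - Hmap n ε η‖ ≤
            ‖Hmap n α ξ - Hmap n α η‖ /
              ((max (‖ξ‖ - 1) 0) ^ ε + (max (‖η‖ - 1) 0) ^ ε) ^ ((α - ε) / ε) ∧
          ‖Hmap n α ξ - Hmap n α η‖ /
              ((max (‖ξ‖ - 1) 0) ^ ε + (max (‖η‖ - 1) 0) ^ ε) ^ ((α - ε) / ε) ≤
            β₂ * ‖Hmap n ε ξ - Hmap n ε η‖ := by
  have hε : 0 < ε := hα.trans hαε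
  refine ⟨(1 / (α / ε) + 2)⁻¹, 6, by positivity, by norm_num, ?_⟩
  intro ξ η
  rcases le_total ‖η‖ ‖ξ‖ with h | h
  · rcases lt_or_ge 1 ‖ξ‖ with h1 | h1
    · exact Hmap_aux n α ε hα hαε ξ η h1 h
    · have e1 : max (‖ξ‖ - 1) 0 = 0 := max_eq_right (by linarith)
      have e2 : max (‖η‖ - 1) 0 = 0 := max_eq_right (by linarith)
      simp [Hmap, e1, e2, Real.zero_rpow hα.ne', Real.zero_rpow hε.ne']
  · rcases lt_or_ge 1 ‖η‖ with h1 | h1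
    · have := Hmap_aux n α ε hα hαε η ξ h1 h
      rwa [norm_sub_rev (Hmap n ε η), norm_sub_rev (Hmap n α η), add_comm (_ ^ ε)] at this
    · have e1 : max (‖ξ‖ - 1) 0 = 0 := max_eq_right (by linarith)
      have e2 : max (‖η‖ - 1) 0 = 0 := max_eq_right (by linarith)
      simp [Hmap, e1, e2, Real.zero_rpow hα.ne', Real.zero_rpow hε.ne']
end

section
/- If 2 ≤ q < ∞, then for every ξ, η ∈ ℝⁿ one has |H_{q−1}(ξ) − H_{q−1}(η)| ≤ (q−1)(|H_{q/2}(ξ)|^{(q−2)/q} + |H_{q/2}(η)|^{(q−2)/q}) |H_{q/2}(ξ) − H_{q/2}(η)|. -/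
lemma aux_real {s A B : ℝ} (hs1 : s ≤ 1) (hB : 0 ≤ B) (hBA : B ≤ A) :
    A ^ s * B ≤ B ^ s * A := by
  have hA : 0 ≤ A := hB.trans hBA
  have key : ∀ x : ℝ, 0 ≤ x → x = x ^ s * x ^ (1 - s) := by
    intro x hx
    rw [← Real.rpow_add' hx (by norm_num)]
    simp
  have h1 : B ^ (1 - s) ≤ A ^ (1 - s) := Real.rpow_le_rpow hB hBA (by linarith)
  have hAs : 0 ≤ A ^ s := Real.rpow_nonneg hA s
  have hBs : 0 ≤ B ^ s := Real.rpow_nonneg hB s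
  calc A ^ s * B = A ^ s * (B ^ s * B ^ (1 - s)) := by rw [← key B hB]
    _ ≤ A ^ s * (B ^ s * A ^ (1 - s)) := by gcongr
    _ = B ^ s * (A ^ s * A ^ (1 - s)) := by ring
    _ = B ^ s * A := by rw [← key A hA]

lemma aux_vec {E : Type*} [NormedAddCommGroup E] [NormedSpace ℝ E] {s : ℝ} (hs0 : 0 ≤ s)
    (hs1 : s ≤ 1) (X Y : E) (h : ‖Y‖ ≤ ‖X‖) :
    ‖‖X‖ ^ s • X - ‖Y‖ ^ s • Y‖ ≤ (‖X‖ ^ s + ‖Y‖ ^ s) * ‖X - Y‖ := by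
  have e : ‖X‖ ^ s • X - ‖Y‖ ^ s • Y = ‖X‖ ^ s • (X - Y) + (‖X‖ ^ s - ‖Y‖ ^ s) • Y := by
    module
  have hX : 0 ≤ ‖X‖ ^ s := Real.rpow_nonneg (norm_nonneg _) s
  have hY : 0 ≤ ‖Y‖ ^ s := Real.rpow_nonneg (norm_nonneg _) s
  have hm : ‖Y‖ ^ s ≤ ‖X‖ ^ s := Real.rpow_le_rpow (norm_nonneg _) h hs0
  have h1 := aux_real hs1 (norm_nonneg Y) h
  have h2 : ‖Y‖ ^ s * (‖X‖ - ‖Y‖) ≤ ‖Y‖ ^ s * ‖X - Y‖ :=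
    mul_le_mul_of_nonneg_left (norm_sub_norm_le X Y) hY
  rw [e]
  refine (norm_add_le _ _).trans ?_
  rw [norm_smul, norm_smul, Real.norm_of_nonneg hX, Real.norm_of_nonneg (sub_nonneg.2 hm)]
  nlinarith

lemma Hmap_norm (n : ℕ) (a : ℝ) (ha : 0 < a) (ξ : EuclideanSpace ℝ (Fin n)) :
    ‖Hmap n a ξ‖ = (max (‖ξ‖ - 1) 0) ^ a := by
  have ht : 0 ≤ (max (‖ξ‖ - 1) 0) ^ a := Real.rpow_nonneg (le_max_right _ _) a
  unfold Hmap
  rw [norm_smul, Real.norm_of_nonneg (div_nonneg ht (norm_nonneg _))]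
  by_cases h : ‖ξ‖ = 0
  · simp [h, Real.zero_rpow ha.ne']
  · field_simp

lemma Hmap_eq (n : ℕ) (q : ℝ) (hq : 2 ≤ q) (ξ : EuclideanSpace ℝ (Fin n)) :
    Hmap n (q - 1) ξ = ‖Hmap n (q / 2) ξ‖ ^ ((q - 2) / q) • Hmap n (q / 2) ξ := by
  rw [Hmap_norm n _ (by linarith)]
  have ht : 0 ≤ max (‖ξ‖ - 1) 0 := le_max_right _ _
  unfold Hmap
  rw [← Real.rpow_mul ht, smul_smul, ← mul_div_assoc, ← Real.rpow_add' ht]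
  · congr 3
    field_simp
    ring
  · have : q / 2 * ((q - 2) / q) + q / 2 = q - 1 := by
      field_simp
      ring
    rw [this]
    linarith

/-- **Lemma.** If `2 ≤ q < ∞`, then for every `ξ, η ∈ ℝⁿ`,
`|H_{q−1}(ξ) − H_{q−1}(η)| ≤ (q−1)(|H_{q/2}(ξ)|^{(q−2)/q} + |H_{q/2}(η)|^{(q−2)/q})
  |H_{q/2}(ξ) − H_{q/2}(η)|`. -/
theorem stmt10 (n : ℕ) (q : ℝ) (hq : 2 ≤ q) (ξ η : EuclideanSpace ℝ (Fin n)) :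
    ‖Hmap n (q - 1) ξ - Hmap n (q - 1) η‖ ≤
      (q - 1) * (‖Hmap n (q / 2) ξ‖ ^ ((q - 2) / q) + ‖Hmap n (q / 2) η‖ ^ ((q - 2) / q)) *
        ‖Hmap n (q / 2) ξ - Hmap n (q / 2) η‖ := by
  rw [Hmap_eq n q hq ξ, Hmap_eq n q hq η]
  generalize Hmap n (q / 2) ξ = X
  generalize Hmap n (q / 2) η = Y
  have hs0 : 0 ≤ (q - 2) / q := div_nonneg (by linarith) (by linarith)
  have hs1 : (q - 2) / q ≤ 1 := (div_le_one (by linarith)).2 (by linarith)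
  generalize (q - 2) / q = s at hs0 hs1
  have main : ‖‖X‖ ^ s • X - ‖Y‖ ^ s • Y‖ ≤ (‖X‖ ^ s + ‖Y‖ ^ s) * ‖X - Y‖ := by
    rcases le_total ‖Y‖ ‖X‖ with h | h
    · exact aux_vec hs0 hs1 X Y h
    · have := aux_vec hs0 hs1 Y X h
      rwa [norm_sub_rev, norm_sub_rev X Y, add_comm]
  have hp : 0 ≤ (‖X‖ ^ s + ‖Y‖ ^ s) * ‖X - Y‖ := by positivity
  nlinarith
end

section
/- If 1 < q < 2, then there exists a constant β = β(q,n) > 0 such that ⟨H_{q−1}(ξ) − H_{q−1}(η), ξ − η⟩ ≥ β |H_{q/2}(ξ) − H_{q/2}(η)|² for every ξ, η ∈ ℝⁿ. -/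
open scoped RealInnerProductSpace

theorem scal_aux (q : ℝ) (hq1 : 1 < q) (hq2 : q < 2) (a b : ℝ) (hb : 0 ≤ b) (hab : b ≤ a) :
    2 * (q - 1) / q * (a ^ (q / 2) - b ^ (q / 2)) ^ 2 ≤ (a ^ (q - 1) - b ^ (q - 1)) * (a - b) := by
  rcases (hb.trans hab).eq_or_lt with h0 | ha
  · have : b = a := by linarith
    subst this
    simp
  obtain ⟨t, ht⟩ : ∃ t, t = b / a := ⟨_, rfl⟩
  have ht0 : 0 ≤ t := by rw [ht]; positivity
  have ht1 : t ≤ 1 := by rw [ht]; exact (div_le_one ha).2 hab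
  have hbt : b = a * t := by rw [ht]; field_simp
  have e1 : b ^ (q - 1) = a ^ (q - 1) * t ^ (q - 1) := by rw [hbt, Real.mul_rpow ha.le ht0]
  have e2 : b ^ (q / 2) = a ^ (q / 2) * t ^ (q / 2) := by rw [hbt, Real.mul_rpow ha.le ht0]
  have e3 : a ^ (q / 2) * a ^ (q / 2) = a ^ (q - 1) * a := by
    rw [← Real.rpow_add ha, ← Real.rpow_add_one ha.ne']
    congr 1; ring
  have hw0 : 0 ≤ t ^ (q / 2) := by positivity
  have hw1 : t ^ (q / 2) ≤ 1 := Real.rpow_le_one ht0 ht1 (by linarith)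
  have hwt : t ≤ t ^ (q / 2) := by
    rcases ht0.eq_or_lt with h | h
    · rw [← h]; positivity
    · simpa using Real.rpow_le_rpow_of_exponent_ge h ht1 (show q / 2 ≤ 1 by linarith)
  have hB : t ^ (q - 1) ≤ 1 + (2 * (q - 1) / q) * (t ^ (q / 2) - 1) := by
    have hh := rpow_one_add_le_one_add_mul_self (s := t ^ (q / 2) - 1) (by linarith)
      (p := 2 * (q - 1) / q) (div_nonneg (by linarith) (by linarith))
      ((div_le_one (by linarith)).2 (by linarith))
    have : (1 + (t ^ (q / 2) - 1)) ^ (2 * (q - 1) / q) = t ^ (q - 1) := by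
      rw [add_sub_cancel, ← Real.rpow_mul ht0]
      congr 1
      field_simp
    rwa [this] at hh
  have hA : 0 ≤ a ^ (q - 1) * a := by positivity
  have hg : 0 ≤ 2 * (q - 1) / q := div_nonneg (by linarith) (by linarith)
  generalize 2 * (q - 1) / q = g at *
  rw [e1, e2, hbt]
  generalize t ^ (q / 2) = w at *
  generalize t ^ (q - 1) = v at *
  have l : g * (1 - w) ^ 2 ≤ (1 - v) * (1 - t) := by
    have h1 : g * (1 - w) ≤ 1 - v := by linarith
    have h2 : 1 - w ≤ 1 - t := by linarith
    have := mul_le_mul h1 h2 (by linarith) (le_trans (mul_nonneg hg (by linarith)) h1)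
    linarith
  have := mul_le_mul_of_nonneg_left l hA
  calc _ = (a ^ (q / 2) * a ^ (q / 2)) * (g * (1 - w) ^ 2) := by ring
    _ = a ^ (q - 1) * a * (g * (1 - w) ^ 2) := by rw [e3]
    _ ≤ _ := this
    _ = _ := by ring

theorem scal_aux' (q : ℝ) (hq1 : 1 < q) (hq2 : q < 2) (r s : ℝ) (hrs : s ≤ r) :
    2 * (q - 1) / q * ((max (r - 1) 0) ^ (q / 2) - (max (s - 1) 0) ^ (q / 2)) ^ 2
      ≤ ((max (r - 1) 0) ^ (q - 1) - (max (s - 1) 0) ^ (q - 1)) * (r - s) := by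
  have hab : max (s - 1) 0 ≤ max (r - 1) 0 := max_le_max (by linarith) le_rfl
  have hb : 0 ≤ max (s - 1) 0 := le_max_right _ _
  refine (scal_aux q hq1 hq2 _ _ hb hab).trans (mul_le_mul_of_nonneg_left ?_ ?_)
  · rcases max_cases (r - 1) 0 with h | h <;> rcases max_cases (s - 1) 0 with h' | h' <;> linarith
  · have := Real.rpow_le_rpow hb hab (show 0 ≤ q - 1 by linarith)
    linarith

theorem scal_cross (q : ℝ) (hq1 : 1 < q) (a b : ℝ) (ha : 0 ≤ a) (hb : 0 ≤ b) :
    2 * (a ^ (q / 2) * b ^ (q / 2)) ≤ a ^ (q - 1) * b + b ^ (q - 1) * a := by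
  rcases ha.eq_or_lt with h | ha
  · rw [← h, Real.zero_rpow (by linarith), Real.zero_rpow (by linarith)]; simp
  rcases hb.eq_or_lt with h | hb
  · rw [← h, Real.zero_rpow (by linarith), Real.zero_rpow (by linarith)]; simp
  have key : ∀ x : ℝ, 0 < x → x ^ (q / 2) = x ^ ((q - 1) / 2) * x ^ ((1 : ℝ) / 2) ∧
      x ^ (q - 1) = (x ^ ((q - 1) / 2)) ^ 2 ∧ x = (x ^ ((1 : ℝ) / 2)) ^ 2 := by
    intro x hx
    refine ⟨?_, ?_, ?_⟩
    · rw [← Real.rpow_add hx]; congr 1; ring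
    · rw [sq, ← Real.rpow_add hx]; congr 1; ring
    · rw [sq, ← Real.rpow_add hx]; norm_num
  obtain ⟨a1, a2, a3⟩ := key a ha
  obtain ⟨b1, b2, b3⟩ := key b hb
  rw [a1, b1, a2, b2]
  generalize a ^ ((q - 1) / 2) = x at *
  generalize b ^ ((q - 1) / 2) = y at *
  generalize a ^ ((1 : ℝ) / 2) = z at *
  generalize b ^ ((1 : ℝ) / 2) = w at *
  rw [a3, b3]
  nlinarith [sq_nonneg (x * w - y * z)]

/-- **Lemma.** If `1 < q < 2`, then there exists a constant `β = β(q,n) > 0` such that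
`⟨H_{q−1}(ξ) − H_{q−1}(η), ξ − η⟩ ≥ β |H_{q/2}(ξ) − H_{q/2}(η)|²` for every `ξ, η ∈ ℝⁿ`. -/
theorem stmt11 (n : ℕ) (q : ℝ) (hq1 : 1 < q) (hq2 : q < 2) :
    ∃ β : ℝ, 0 < β ∧
      ∀ ξ η : EuclideanSpace ℝ (Fin n),
        ⟪Hmap n (q - 1) ξ - Hmap n (q - 1) η, ξ - η⟫ ≥
          β * ‖Hmap n (q / 2) ξ - Hmap n (q / 2) η‖ ^ 2 := by
  have hg : 0 < 2 * (q - 1) / q := div_pos (by linarith) (by linarith)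
  have hg1 : 2 * (q - 1) / q ≤ 1 := (div_le_one (by linarith)).2 (by linarith)
  refine ⟨2 * (q - 1) / q, hg, fun ξ η => ?_⟩
  have hdec : ∀ x : EuclideanSpace ℝ (Fin n), ∃ e : EuclideanSpace ℝ (Fin n),
      x = ‖x‖ • e ∧ (∀ p, Hmap n p x = ((max (‖x‖ - 1) 0) ^ p) • e) ∧ ‖e‖ ≤ 1 ∧
      (∀ p : ℝ, 0 < p → (max (‖x‖ - 1) 0) ^ p * ⟪e, e⟫ = (max (‖x‖ - 1) 0) ^ p) := by
    intro x
    refine ⟨‖x‖⁻¹ • x, ?_, ?_, ?_, ?_⟩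
    · by_cases hx : x = 0
      · simp [hx]
      · rw [smul_smul, mul_inv_cancel₀ (norm_ne_zero_iff.2 hx), one_smul]
    · intro p
      rw [Hmap, smul_smul, div_eq_mul_inv]
    · rw [norm_smul, norm_inv, norm_norm]
      exact inv_mul_le_one
    · intro p hp
      by_cases hx : x = 0
      · simp [hx, Real.zero_rpow hp.ne']
      · rw [real_inner_self_eq_norm_sq, norm_smul, norm_inv, norm_norm,
          inv_mul_cancel₀ (norm_ne_zero_iff.2 hx)]
        simp
  obtain ⟨e, he, heH, he1, hee⟩ := hdec ξ
  obtain ⟨f, hf, hfH, hf1, hff⟩ := hdec η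
  have hu : ⟪e, f⟫ ≤ 1 := (real_inner_le_norm e f).trans
    (mul_le_one₀ he1 (norm_nonneg _) hf1)
  have hr := norm_nonneg ξ
  have hs := norm_nonneg η
  have hmain : 2 * (q - 1) / q * ((max (‖ξ‖ - 1) 0) ^ (q / 2) - (max (‖η‖ - 1) 0) ^ (q / 2)) ^ 2
      ≤ ((max (‖ξ‖ - 1) 0) ^ (q - 1) - (max (‖η‖ - 1) 0) ^ (q - 1)) * (‖ξ‖ - ‖η‖) := by
    rcases le_total ‖η‖ ‖ξ‖ with h | h
    · exact scal_aux' q hq1 hq2 _ _ h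
    · have := scal_aux' q hq1 hq2 _ _ h
      linarith
  have ha : 0 ≤ max (‖ξ‖ - 1) 0 := le_max_right _ _
  have hb : 0 ≤ max (‖η‖ - 1) 0 := le_max_right _ _
  have har : max (‖ξ‖ - 1) 0 ≤ ‖ξ‖ := max_le (by linarith) hr
  have hbs : max (‖η‖ - 1) 0 ≤ ‖η‖ := max_le (by linarith) hs
  have hcr := scal_cross q hq1 _ _ ha hb
  have eA := hee (q - 1) (by linarith)
  have eP := hee (q / 2) (by linarith)
  have eB := hff (q - 1) (by linarith)
  have eQ := hff (q / 2) (by linarith)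
  have hA := Real.rpow_nonneg ha (q - 1)
  have hB := Real.rpow_nonneg hb (q - 1)
  have hP := Real.rpow_nonneg ha (q / 2)
  have hQ := Real.rpow_nonneg hb (q / 2)
  rw [heH, hfH, heH, hfH, ← real_inner_self_eq_norm_sq]
  generalize max (‖ξ‖ - 1) 0 = a at *
  generalize max (‖η‖ - 1) 0 = b at *
  generalize ‖ξ‖ = r at *
  generalize ‖η‖ = s at *
  rw [he, hf]
  simp only [inner_sub_left, inner_sub_right, real_inner_smul_left, real_inner_smul_right]
  rw [real_inner_comm e f]
  generalize a ^ (q - 1) = A at *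
  generalize b ^ (q - 1) = B at *
  generalize a ^ (q / 2) = P at *
  generalize b ^ (q / 2) = Q at *
  generalize 2 * (q - 1) / q = g at *
  generalize ⟪e, f⟫ = u at *
  generalize ⟪e, e⟫ = x at *
  generalize ⟪f, f⟫ = y at *
  have h1 : 2 * (P * Q) ≤ A * s + B * r :=
    hcr.trans (add_le_add (mul_le_mul_of_nonneg_left hbs hA) (mul_le_mul_of_nonneg_left har hB))
  have h2 : g * (2 * (P * Q)) ≤ A * s + B * r :=
    (mul_le_of_le_one_left (by positivity) hg1).trans h1
  have h3 := mul_le_mul_of_nonneg_right h2 (sub_nonneg.2 hu)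
  have k1 : P * (P * x) = P * P := by rw [eP]
  have k2 : Q * (Q * y) = Q * Q := by rw [eQ]
  have k3 : A * x * r = A * r := by rw [eA]
  have k4 : B * y * s = B * s := by rw [eB]
  linear_combination h3 + hmain + g * k1 + g * k2 - k3 - k4
end

section
/- Let γ ∈ (−1, 0). Then there exist positive constants k₃(γ) and k₄(γ,n) such that k₃ |z−w| ≤ | |z|^γ z − |w|^γ w | / (|z| + |w|)^γ ≤ k₄ |z−w| for all z, w ∈ ℝⁿ (with |z|^γ z interpreted as 0 when z = 0). -/
theorem stmt13_aux {E : Type*} [NormedAddCommGroup E] [InnerProductSpace ℝ E]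
    (γ : ℝ) (hγ1 : -1 < γ) (hγ2 : γ < 0) (z w : E) (hz : 0 < ‖z‖) (hwz : ‖w‖ ≤ ‖z‖) :
    (1 + γ) * ‖z - w‖ ≤ ‖‖z‖ ^ γ • z - ‖w‖ ^ γ • w‖ / (‖z‖ + ‖w‖) ^ γ ∧
      ‖‖z‖ ^ γ • z - ‖w‖ ^ γ • w‖ / (‖z‖ + ‖w‖) ^ γ ≤ 4 * ‖z - w‖ := by
  have hb : 0 ≤ ‖w‖ := norm_nonneg w
  have hS : 0 < (‖z‖ + ‖w‖) ^ γ := Real.rpow_pos_of_pos (by linarith) _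
  have hx : 0 < ‖z‖ ^ γ := Real.rpow_pos_of_pos hz _
  have hy : 0 ≤ ‖w‖ ^ γ := Real.rpow_nonneg hb _
  have hS1 : (‖z‖ + ‖w‖) ^ γ ≤ ‖z‖ ^ γ :=
    Real.rpow_le_rpow_of_nonpos hz (by linarith) hγ2.le
  have hS2 : ‖z‖ ^ γ ≤ 2 * (‖z‖ + ‖w‖) ^ γ := by
    have h1 : (2 * ‖z‖) ^ γ ≤ (‖z‖ + ‖w‖) ^ γ :=
      Real.rpow_le_rpow_of_nonpos (by linarith) (by linarith) hγ2.le
    rw [Real.mul_rpow (by norm_num) hz.le] at h1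
    have h2 : (2:ℝ) ^ (-1:ℝ) ≤ 2 ^ γ :=
      Real.rpow_le_rpow_of_exponent_le (by norm_num) hγ1.le
    rw [Real.rpow_neg_one] at h2
    nlinarith
  have hxy : ‖w‖ = 0 ∨ ‖z‖ ^ γ ≤ ‖w‖ ^ γ := by
    rcases hb.eq_or_lt with h | h
    · exact Or.inl h.symm
    · exact Or.inr (Real.rpow_le_rpow_of_nonpos h hwz hγ2.le)
  have hlow : (1 + γ) * (‖z‖ ^ γ * (‖z‖ - ‖w‖)) ≤ ‖z‖ ^ γ * ‖z‖ - ‖w‖ ^ γ * ‖w‖ := by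
    rcases hb.eq_or_lt with h | h
    · rw [← h]; nlinarith [mul_pos hx hz]
    · have hB := rpow_one_add_le_one_add_mul_self (s := ‖w‖ / ‖z‖ - 1) (p := 1 + γ)
        (by have := div_nonneg hb hz.le; linarith) (by linarith) (by linarith)
      rw [add_sub_cancel, Real.rpow_add (div_pos h hz), Real.rpow_one,
        Real.div_rpow hb hz.le] at hB
      have h3 := mul_le_mul_of_nonneg_left hB (mul_pos hx hz).le
      have e1 : ‖z‖ ^ γ * ‖z‖ * (‖w‖ / ‖z‖ * (‖w‖ ^ γ / ‖z‖ ^ γ)) = ‖w‖ ^ γ * ‖w‖ := by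
        field_simp
      have e2 : ‖z‖ ^ γ * ‖z‖ * (1 + (1 + γ) * (‖w‖ / ‖z‖ - 1))
          = ‖z‖ ^ γ * ‖z‖ + (1 + γ) * (‖z‖ ^ γ * (‖w‖ - ‖z‖)) := by
        field_simp
      rw [e1, e2] at h3
      linarith
  generalize (‖z‖ + ‖w‖) ^ γ = S at *
  generalize ‖z‖ ^ γ = x at *
  generalize ‖w‖ ^ γ = y at *
  have hzw : ‖z‖ - ‖w‖ ≤ ‖z - w‖ := norm_sub_norm_le z w
  have hd : 0 ≤ x * (‖z‖ - ‖w‖) := mul_nonneg hx.le (by linarith)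
  constructor
  · rw [le_div_iff₀ hS]
    have key : (1 + γ) * x * ‖z - w‖ ≤ ‖x • z - y • w‖ := by
      refine le_of_not_gt fun hc => absurd (pow_lt_pow_left₀ hc (norm_nonneg _) two_ne_zero) (not_lt.2 ?_)
      rw [mul_pow, norm_sub_sq_real, norm_sub_sq_real, norm_smul, norm_smul,
        real_inner_smul_left, real_inner_smul_right, Real.norm_of_nonneg hx.le,
        Real.norm_of_nonneg hy]
      have hin := real_inner_le_norm z w
      have h0 : ‖w‖ = 0 → inner ℝ z w = 0 := by
        intro h; rw [norm_eq_zero] at h; simp [h]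
      generalize inner ℝ z w = i at *
      have hp : x * x * (‖z‖ * ‖w‖ - i) ≤ x * y * (‖z‖ * ‖w‖ - i) := by
        rcases hxy with h | h
        · rw [h0 h, h]; simp
        · exact mul_le_mul_of_nonneg_right (mul_le_mul_of_nonneg_left h hx.le) (by linarith)
      have hq : (1 + γ) ^ 2 * (x * x * (‖z‖ * ‖w‖ - i)) ≤ x * x * (‖z‖ * ‖w‖ - i) := by
        have : 0 ≤ x * x * (‖z‖ * ‖w‖ - i) := mul_nonneg (mul_nonneg hx.le hx.le) (by linarith)
        have h1 : (1 + γ) ^ 2 ≤ 1 := by nlinarith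
        nlinarith
      have hr := pow_le_pow_left₀ (mul_nonneg (by linarith) hd) hlow 2
      nlinarith
    have : (1 + γ) * ‖z - w‖ * S ≤ (1 + γ) * ‖z - w‖ * x :=
      mul_le_mul_of_nonneg_left hS1 (mul_nonneg (by linarith) (norm_nonneg _))
    linarith
  · rw [div_le_iff₀ hS]
    have e : x • z - y • w = x • (z - w) - (y - x) • w := by
      rw [smul_sub, sub_smul]; abel
    have h1 : ‖x • z - y • w‖ ≤ x * ‖z - w‖ + |y - x| * ‖w‖ := by
      rw [e]
      refine (norm_sub_le _ _).trans ?_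
      rw [norm_smul, norm_smul, Real.norm_of_nonneg hx.le, Real.norm_eq_abs]
    have h2 : |y - x| * ‖w‖ ≤ x * (‖z‖ - ‖w‖) := by
      rcases hxy with h | h
      · rw [h] at hd ⊢; simpa using hd
      · rw [abs_of_nonneg (by linarith)]
        nlinarith [mul_nonneg (by linarith : 0 ≤ 1 + γ) hd]
    have h3 := mul_le_mul_of_nonneg_left hzw hx.le
    have h4 := mul_le_mul_of_nonneg_right hS2 (norm_nonneg (z - w))
    linarith

/-- **Lemma.** Let `γ ∈ (−1, 0)`.  Then there exist positive constants `k₃(γ)` and `k₄(γ,n)`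
such that `k₃ |z−w| ≤ ||z|^γ z − |w|^γ w| / (|z| + |w|)^γ ≤ k₄ |z−w|` for all `z, w ∈ ℝⁿ`
(`|z|^γ z` being interpreted as `0` when `z = 0`). -/
theorem stmt13 (n : ℕ) (γ : ℝ) (hγ1 : -1 < γ) (hγ2 : γ < 0) :
    ∃ k₃ k₄ : ℝ, 0 < k₃ ∧ 0 < k₄ ∧
      ∀ z w : EuclideanSpace ℝ (Fin n),
        k₃ * ‖z - w‖ ≤ ‖‖z‖ ^ γ • z - ‖w‖ ^ γ • w‖ / (‖z‖ + ‖w‖) ^ γ ∧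
          ‖‖z‖ ^ γ • z - ‖w‖ ^ γ • w‖ / (‖z‖ + ‖w‖) ^ γ ≤ k₄ * ‖z - w‖ := by
  refine ⟨1 + γ, 4, by linarith, by norm_num, fun z w => ?_⟩
  rcases le_total ‖w‖ ‖z‖ with h | h
  · rcases (norm_nonneg z).eq_or_lt with h0 | h0
    · have hw : w = 0 := norm_eq_zero.1 (le_antisymm (h0 ▸ h) (norm_nonneg w))
      have hz : z = 0 := norm_eq_zero.1 h0.symm
      subst hw hz
      simp
    · exact stmt13_aux γ hγ1 hγ2 z w h0 h
  · rcases (norm_nonneg w).eq_or_lt with h0 | h0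
    · have hz : z = 0 := norm_eq_zero.1 (le_antisymm (h0 ▸ h) (norm_nonneg z))
      have hw : w = 0 := norm_eq_zero.1 h0.symm
      subst hw hz
      simp
    · have := stmt13_aux γ hγ1 hγ2 w z h0 h
      rwa [norm_sub_rev w z, norm_sub_rev (‖w‖ ^ γ • w), add_comm ‖w‖] at this
end

section
/- Let 1 < q < 2. Then for all z, w ∈ ℝⁿ one has ⟨|z|^{q−2} z − |w|^{q−2} w, z − w⟩ ≥ (q−1)(|z|² + |w|²)^{(q−2)/2} |z−w|² ≥ β(q,n) | |z|^{(q−2)/2} z − |w|^{(q−2)/2} w |², where β(q,n) > 0 is a constant depending only on q and n (with |z|^{q−2} z and |z|^{(q−2)/2} z interpreted as 0 when z = 0). -/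
open scoped RealInnerProductSpace

theorem aux1 {E : Type*} [NormedAddCommGroup E] [InnerProductSpace ℝ E] (q : ℝ) (hq1 : 1 < q)
    (hq2 : q < 2) (z w : E) (hz : 0 < ‖z‖) (hwz : ‖w‖ ≤ ‖z‖) :
    (q - 1) * (‖z‖ ^ 2 + ‖w‖ ^ 2) ^ ((q - 2) / 2) * ‖z - w‖ ^ 2 ≤
    ⟪‖z‖ ^ (q - 2) • z - ‖w‖ ^ (q - 2) • w, z - w⟫ := by
  have hnorm : ∀ x : E, 0 < ‖x‖ → ‖x‖ ^ 2 ≤ ‖z‖ ^ 2 + ‖w‖ ^ 2 →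
      (‖z‖ ^ 2 + ‖w‖ ^ 2) ^ ((q - 2) / 2) ≤ ‖x‖ ^ (q - 2) := by
    intro x hx hle
    have h1 : ‖x‖ ^ (q - 2) = (‖x‖ ^ 2) ^ ((q - 2) / 2) := by
      rw [← Real.rpow_natCast, ← Real.rpow_mul hx.le]
      congr 1; push_cast; ring
    rw [h1]
    exact Real.rpow_le_rpow_of_nonpos (by positivity) hle (by linarith)
  have hA := hnorm z hz (by nlinarith [sq_nonneg ‖w‖])
  have hS : 0 ≤ (‖z‖ ^ 2 + ‖w‖ ^ 2) ^ ((q - 2) / 2) := by positivity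
  have hsq : ‖z - w‖ ^ 2 = ‖z‖ ^ 2 - 2 * ⟪z, w⟫ + ‖w‖ ^ 2 := norm_sub_sq_real z w
  have hin : ⟪‖z‖ ^ (q - 2) • z - ‖w‖ ^ (q - 2) • w, z - w⟫ =
      ‖z‖ ^ (q - 2) * (‖z‖ ^ 2 - ⟪z, w⟫) + ‖w‖ ^ (q - 2) * (‖w‖ ^ 2 - ⟪z, w⟫) := by
    simp only [inner_sub_left, inner_sub_right, real_inner_smul_left, real_inner_self_eq_norm_sq,
      real_inner_comm z w]
    ring
  have hc : ⟪z, w⟫ ≤ ‖z‖ * ‖w‖ := real_inner_le_norm z w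
  rw [hin, hsq]
  rcases (norm_nonneg w).eq_or_lt with hw | hw
  · have hw0 : w = 0 := norm_eq_zero.mp hw.symm
    subst hw0
    simp only [norm_zero, inner_zero_right] at *
    have : (q - 1) * (‖z‖ ^ 2 + 0 ^ 2) ^ ((q - 2) / 2) ≤ ‖z‖ ^ (q - 2) := by nlinarith
    nlinarith [mul_le_mul_of_nonneg_right this (sq_nonneg ‖z‖)]
  · have hB := hnorm w hw (by nlinarith [sq_nonneg ‖z‖])
    have hbern : ‖w‖ ^ (q - 2) * ‖w‖ ≤ ‖z‖ ^ (q - 2) * (‖z‖ + (q - 1) * (‖w‖ - ‖z‖)) := by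
      have h := rpow_one_add_le_one_add_mul_self (s := ‖w‖ / ‖z‖ - 1) (p := q - 1)
        (by have : 0 ≤ ‖w‖ / ‖z‖ := by positivity
            linarith) (by linarith) (by linarith)
      rw [add_sub_cancel, Real.div_rpow hw.le hz.le, div_le_iff₀ (by positivity)] at h
      have e1 : ‖w‖ ^ (q - 1) = ‖w‖ ^ (q - 2) * ‖w‖ := by
        rw [← Real.rpow_add_one hw.ne']; congr 1; ring
      have e2 : ‖z‖ ^ (q - 1) = ‖z‖ ^ (q - 2) * ‖z‖ := by
        rw [← Real.rpow_add_one hz.ne']; congr 1; ring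
      rw [e1, e2] at h
      refine h.trans (le_of_eq ?_)
      field_simp
    generalize (‖z‖ ^ 2 + ‖w‖ ^ 2) ^ ((q - 2) / 2) = S at *
    generalize ‖z‖ ^ (q - 2) = A at *
    generalize ‖w‖ ^ (q - 2) = B at *
    generalize ⟪z, w⟫ = c at *
    generalize ‖z‖ = a at *
    generalize ‖w‖ = b at *
    have hqS : (q - 1) * S ≤ S := by nlinarith
    have k1 : 0 ≤ (A + B - 2 * ((q - 1) * S)) * (a * b - c) :=
      mul_nonneg (by linarith) (by linarith)
    have k2 : 0 ≤ (A * (a + (q - 1) * (b - a)) - B * b) * (a - b) :=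
      mul_nonneg (by linarith) (by linarith)
    have k3 : 0 ≤ (q - 1) * (A - S) * (a - b) ^ 2 :=
      mul_nonneg (mul_nonneg (by linarith) (by linarith)) (sq_nonneg _)
    linarith

theorem aux2 {E : Type*} [NormedAddCommGroup E] [InnerProductSpace ℝ E] (q : ℝ) (hq1 : 1 < q)
    (hq2 : q < 2) (z w : E) (hz : 0 < ‖z‖) (hwz : ‖w‖ ≤ ‖z‖) :
    ((q - 1) * 2 ^ ((q - 2) / 2) / 4) * ‖‖z‖ ^ ((q - 2) / 2) • z - ‖w‖ ^ ((q - 2) / 2) • w‖ ^ 2 ≤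
    (q - 1) * (‖z‖ ^ 2 + ‖w‖ ^ 2) ^ ((q - 2) / 2) * ‖z - w‖ ^ 2 := by
  obtain ⟨r, hr⟩ : ∃ r, r = (q - 2) / 2 := ⟨_, rfl⟩
  rw [← hr]
  have hA : 0 ≤ ‖z‖ ^ r := by positivity
  have hS : 2 ^ r * (‖z‖ ^ r) ^ 2 ≤ (‖z‖ ^ 2 + ‖w‖ ^ 2) ^ r := by
    have : 2 ^ r * (‖z‖ ^ r) ^ 2 = (2 * ‖z‖ ^ 2) ^ r := by
      rw [Real.mul_rpow (by norm_num) (by positivity), sq, sq, Real.mul_rpow hz.le hz.le]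
    rw [this]
    refine Real.rpow_le_rpow_of_nonpos (by positivity) ?_ (by linarith)
    nlinarith [norm_nonneg w]
  have hV : ‖‖z‖ ^ r • z - ‖w‖ ^ r • w‖ ≤ 2 * ‖z‖ ^ r * ‖z - w‖ := by
    have hsub : ‖z‖ - ‖w‖ ≤ ‖z - w‖ := norm_sub_norm_le z w
    have e : ‖z‖ ^ r • z - ‖w‖ ^ r • w = ‖z‖ ^ r • (z - w) + (‖z‖ ^ r - ‖w‖ ^ r) • w := by
      module
    have h2 : ‖(‖z‖ ^ r - ‖w‖ ^ r) • w‖ ≤ ‖z‖ ^ r * ‖z - w‖ := by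
      rcases (norm_nonneg w).eq_or_lt with hw | hw
      · have hw0 : w = 0 := norm_eq_zero.mp hw.symm
        rw [hw0, smul_zero, norm_zero]; positivity
      · have hAB : ‖z‖ ^ r ≤ ‖w‖ ^ r := Real.rpow_le_rpow_of_nonpos hw hwz (by linarith)
        have hm : ‖w‖ ^ r * ‖w‖ ≤ ‖z‖ ^ r * ‖z‖ := by
          rw [← Real.rpow_add_one hw.ne', ← Real.rpow_add_one hz.ne']
          exact Real.rpow_le_rpow hw.le hwz (by linarith)
        rw [norm_smul, Real.norm_eq_abs, abs_of_nonpos (by linarith)]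
        nlinarith [mul_le_mul_of_nonneg_left hsub hA]
    rw [e]
    refine (norm_add_le _ _).trans ?_
    rw [norm_smul, Real.norm_eq_abs, abs_of_nonneg hA]
    linarith
  have hV2 := pow_le_pow_left₀ (norm_nonneg _) hV 2
  have h2 : (0:ℝ) < 2 ^ r := by positivity
  have hq : 0 < q - 1 := by linarith
  calc _ ≤ ((q - 1) * 2 ^ r / 4) * (2 * ‖z‖ ^ r * ‖z - w‖) ^ 2 := by gcongr
    _ = (q - 1) * (2 ^ r * (‖z‖ ^ r) ^ 2) * ‖z - w‖ ^ 2 := by ring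
    _ ≤ _ := by gcongr

/-- **Lemma.** Let `1 < q < 2`.  Then for all `z, w ∈ ℝⁿ`,
`⟨|z|^{q−2} z − |w|^{q−2} w, z − w⟩ ≥ (q−1)(|z|² + |w|²)^{(q−2)/2} |z−w|²
  ≥ β(q,n) ||z|^{(q−2)/2} z − |w|^{(q−2)/2} w|²`,
where `β(q,n) > 0` depends only on `q` and `n` (`|z|^{q−2} z` and `|z|^{(q−2)/2} z` being
interpreted as `0` when `z = 0`). -/
theorem stmt14 (n : ℕ) (q : ℝ) (hq1 : 1 < q) (hq2 : q < 2) :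
    ∃ β : ℝ, 0 < β ∧
      ∀ z w : EuclideanSpace ℝ (Fin n),
        ⟪‖z‖ ^ (q - 2) • z - ‖w‖ ^ (q - 2) • w, z - w⟫ ≥
            (q - 1) * (‖z‖ ^ 2 + ‖w‖ ^ 2) ^ ((q - 2) / 2) * ‖z - w‖ ^ 2 ∧
          (q - 1) * (‖z‖ ^ 2 + ‖w‖ ^ 2) ^ ((q - 2) / 2) * ‖z - w‖ ^ 2 ≥
            β * ‖‖z‖ ^ ((q - 2) / 2) • z - ‖w‖ ^ ((q - 2) / 2) • w‖ ^ 2 := by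
  refine ⟨(q - 1) * 2 ^ ((q - 2) / 2) / 4, ?_, ?_⟩
  · have hq : 0 < q - 1 := by linarith
    positivity
  intro z w
  rcases (add_nonneg (norm_nonneg z) (norm_nonneg w)).eq_or_lt with h0 | h0
  · have hz0 : z = 0 := norm_eq_zero.mp (by linarith [norm_nonneg z, norm_nonneg w])
    have hw0 : w = 0 := norm_eq_zero.mp (by linarith [norm_nonneg z, norm_nonneg w])
    subst hz0 hw0
    simp
  rcases le_total ‖w‖ ‖z‖ with h | h
  · have hz : 0 < ‖z‖ := by linarith
    exact ⟨aux1 q hq1 hq2 z w hz h, aux2 q hq1 hq2 z w hz h⟩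
  · have hw : 0 < ‖w‖ := by linarith
    have h1 := aux1 q hq1 hq2 w z hw h
    have h2 := aux2 q hq1 hq2 w z hw h
    rw [add_comm (‖w‖ ^ 2), norm_sub_rev w z] at h1 h2
    rw [norm_sub_rev (‖w‖ ^ ((q - 2) / 2) • w)] at h2
    rw [← inner_neg_neg, neg_sub, neg_sub] at h1
    exact ⟨h1, h2⟩
end
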